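/- arXiv:2601.08772 — 2 statements merged into one kernel-verified Lean document; each statement's English description precedes it below -/
import Mathlib

section
/- For every θ ∈ ℝ and every γ ∈ [0, 1/2], all four noisy quasiprobability coefficients are nonnegative (a_k(θ,γ) ≥ 0 for k = 0,1,2,3) if and only if (1−2γ)(|sin θ| + |cos θ|) ≤ 1. In particular, beyond the critical noise level γ_c = (1/2)(1 − 1/(|sin θ|+|cos θ|)) the noisy rotation channel is a convex (probabilistic) combination of the four Clifford-angle rotation channels. -/
/-- The noisy quasiprobability coefficients `a_k(θ,γ)`. -/
noncomputable def qpCoeffNoisy (θ γ : ℝ) : Fin 4 → ℝ :=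
  ![|Real.cos θ| / (2 * (|Real.sin θ| + |Real.cos θ|)) + (1 - 2 * γ) * Real.cos θ / 2,
    |Real.sin θ| / (2 * (|Real.sin θ| + |Real.cos θ|)) + (1 - 2 * γ) * Real.sin θ / 2,
    |Real.cos θ| / (2 * (|Real.sin θ| + |Real.cos θ|)) - (1 - 2 * γ) * Real.cos θ / 2,
    |Real.sin θ| / (2 * (|Real.sin θ| + |Real.cos θ|)) - (1 - 2 * γ) * Real.sin θ / 2]

theorem abs_div_add_sub_nonneg_iff {S c : ℝ} (hS : 0 < S) (hc : 0 ≤ c) (x : ℝ) :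
    (0 ≤ |x| / (2 * S) + c * x / 2 ∧ 0 ≤ |x| / (2 * S) - c * x / 2) ↔
      x = 0 ∨ c * S ≤ 1 := by
  have key : (0 ≤ |x| / (2 * S) + c * x / 2 ∧ 0 ≤ |x| / (2 * S) - c * x / 2) ↔
      |c * x / 2| ≤ |x| / (2 * S) := by
    rw [abs_le]
    constructor <;> rintro ⟨h₁, h₂⟩ <;> constructor <;> linarith
  rw [key, abs_div, abs_mul, abs_of_nonneg hc, abs_two, le_div_iff₀ (by positivity),
    show c * |x| / 2 * (2 * S) = c * S * |x| by ring]
  rcases eq_or_ne x 0 with rfl | hx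
  · simp
  · simp [hx, mul_le_iff_le_one_left (abs_pos.mpr hx)]

theorem abs_sin_add_abs_cos_pos (θ : ℝ) : 0 < |Real.sin θ| + |Real.cos θ| := by
  by_cases h : Real.sin θ = 0
  · have hcos : Real.cos θ ≠ 0 := fun h' => by
      simpa [h, h'] using Real.sin_sq_add_cos_sq θ
    positivity
  · positivity

theorem qpCoeffNoisy_nonneg_iff_mul_le_one {θ γ : ℝ} (hγ : γ ≤ 1 / 2) :
    (∀ k : Fin 4, 0 ≤ qpCoeffNoisy θ γ k) ↔
      (1 - 2 * γ) * (|Real.sin θ| + |Real.cos θ|) ≤ 1 := by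
  have hS := abs_sin_add_abs_cos_pos θ
  have hc : 0 ≤ 1 - 2 * γ := by linarith
  have hcos := abs_div_add_sub_nonneg_iff hS hc (Real.cos θ)
  have hsin := abs_div_add_sub_nonneg_iff hS hc (Real.sin θ)
  simp only [Fin.forall_fin_succ, qpCoeffNoisy]
  constructor
  · rintro ⟨h₀, h₁, h₂, h₃, -⟩
    rcases hcos.mp ⟨h₀, h₂⟩ with hx | h
    · rcases hsin.mp ⟨h₁, h₃⟩ with hy | h
      · simp [hx, hy] at hS
      · exact h
    · exact h
  · intro h
    obtain ⟨h₀, h₂⟩ := hcos.mpr (Or.inr h)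
    obtain ⟨h₁, h₃⟩ := hsin.mpr (Or.inr h)
    exact ⟨h₀, h₁, h₂, h₃, fun k => k.elim0⟩

/-- For `γ ∈ [0, 1/2]`, all four noisy quasiprobability coefficients are
nonnegative if and only if `(1−2γ)(|sin θ| + |cos θ|) ≤ 1`; in particular,
beyond the critical noise level `γ_c = (1/2)(1 − 1/(|sin θ|+|cos θ|))` the
noisy rotation channel is a convex combination of the four Clifford-angle
rotation channels. -/
theorem noisy_qpCoeff_nonneg_iff (θ γ : ℝ) (hγ : γ ∈ Set.Icc (0 : ℝ) (1 / 2)) :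
    ((∀ k : Fin 4, 0 ≤ qpCoeffNoisy θ γ k) ↔
      (1 - 2 * γ) * (|Real.sin θ| + |Real.cos θ|) ≤ 1) ∧
    ((1 / 2) * (1 - 1 / (|Real.sin θ| + |Real.cos θ|)) ≤ γ →
      ∀ k : Fin 4, 0 ≤ qpCoeffNoisy θ γ k) := by
  have hiff := qpCoeffNoisy_nonneg_iff_mul_le_one (θ := θ) hγ.2
  refine ⟨hiff, fun h => hiff.mpr ?_⟩
  rw [← le_div_iff₀ (abs_sin_add_abs_cos_pos θ)]
  linarith
end

section
/- (Observation 3, restored transferability via Pauli insertions.) Let θ, φ ∈ ℝ and γ₁, γ₂ ∈ ℝ with γ₁ ≠ 1/2 and γ₂ ≠ 1/2. Let a : {0,1,2,3}² → ℝ be coefficients satisfying both the noisy relation Tr[(X+Z)·Ñ(θ,φ)] = Σ_{k,l=0}^{3} a_{k,l} · Tr[(X+Z)·Ñ(kπ/2, lπ/2)] and the Pauli-inserted noisy relation Tr[(X+Z)·Ñᴾ(θ,φ)] = Σ_{k,l=0}^{3} a_{k,l} · Tr[(X+Z)·Ñᴾ(kπ/2, lπ/2)]. Then the same coefficients satisfy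 the noiseless relation Tr[(X+Z)·N(θ,φ)] = Σ_{k,l=0}^{3} a_{k,l} · Tr[(X+Z)·N(kπ/2, lπ/2)]. -/
open Matrix

/-- The Pauli X matrix. -/
noncomputable def Xg : Matrix (Fin 2) (Fin 2) ℂ := !![0, 1; 1, 0]

/-- The Pauli Z matrix. -/
noncomputable def Zg : Matrix (Fin 2) (Fin 2) ℂ := !![1, 0; 0, -1]

/-- The Z-rotation `R_Z(β) = diag(e^{−iβ/2}, e^{iβ/2})`. -/
noncomputable def RZg (β : ℝ) : Matrix (Fin 2) (Fin 2) ℂ :=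
  !![Complex.exp (-(Complex.I * (β : ℂ)) / 2), 0;
     0, Complex.exp (Complex.I * (β : ℂ) / 2)]

/-- The X-rotation `R_X(α) = cos(α/2)·I − i·sin(α/2)·X`. -/
noncomputable def RXg (α : ℝ) : Matrix (Fin 2) (Fin 2) ℂ :=
  (Real.cos (α / 2) : ℂ) • (1 : Matrix (Fin 2) (Fin 2) ℂ) -
    (Complex.I * (Real.sin (α / 2) : ℂ)) • Xg

/-- The state `|0⟩⟨0|`. -/
noncomputable def rho0 : Matrix (Fin 2) (Fin 2) ℂ := !![1, 0; 0, 0]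

/-- The Pauli noise channel `E_X(σ) = (1−γ)σ + γ·XσX`. -/
noncomputable def EXc (γ : ℝ) (σ : Matrix (Fin 2) (Fin 2) ℂ) :
    Matrix (Fin 2) (Fin 2) ℂ :=
  ((1 - γ : ℝ) : ℂ) • σ + (γ : ℂ) • (Xg * σ * Xg)

/-- The Pauli noise channel `E_Z(σ) = (1−γ)σ + γ·ZσZ`. -/
noncomputable def EZc (γ : ℝ) (σ : Matrix (Fin 2) (Fin 2) ℂ) :
    Matrix (Fin 2) (Fin 2) ℂ :=
  ((1 - γ : ℝ) : ℂ) • σ + (γ : ℂ) • (Zg * σ * Zg)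

/-- Noiseless circuit output `N(α,β) = R_Z(β) R_X(α) ρ₀ R_X(α)† R_Z(β)†`. -/
noncomputable def noiselessOut (α β : ℝ) : Matrix (Fin 2) (Fin 2) ℂ :=
  RZg β * (RXg α * rho0 * (RXg α)ᴴ) * (RZg β)ᴴ

/-- Noisy circuit output
`Ñ(α,β) = E_Z(R_Z(β)·E_X(R_X(α) ρ₀ R_X(α)†)·R_Z(β)†)`. -/
noncomputable def noisyOut (γ₁ γ₂ α β : ℝ) : Matrix (Fin 2) (Fin 2) ℂ :=
  EZc γ₂ (RZg β * EXc γ₁ (RXg α * rho0 * (RXg α)ᴴ) * (RZg β)ᴴ)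

/-- Pauli-inserted noisy circuit output
`Ñᴾ(α,β) = E_Z(Z·R_Z(β)·E_X(X·R_X(α) ρ₀ R_X(α)†·X)·R_Z(β)†·Z)`. -/
noncomputable def noisyOutP (γ₁ γ₂ α β : ℝ) : Matrix (Fin 2) (Fin 2) ℂ :=
  EZc γ₂ (Zg * RZg β * EXc γ₁ (Xg * (RXg α * rho0 * (RXg α)ᴴ) * Xg) * (RZg β)ᴴ * Zg)

theorem RXg_state (α : ℝ) :
    RXg α * rho0 * (RXg α)ᴴ =
      !![(Real.cos (α / 2) : ℂ) ^ 2,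
          Complex.I * Real.cos (α / 2) * Real.sin (α / 2);
        -(Complex.I * Real.cos (α / 2) * Real.sin (α / 2)),
          (Real.sin (α / 2) : ℂ) ^ 2] := by
  have hR : RXg α = !![(Real.cos (α / 2) : ℂ), -(Complex.I * Real.sin (α / 2));
      -(Complex.I * Real.sin (α / 2)), (Real.cos (α / 2) : ℂ)] := by
    ext i j
    fin_cases i <;> fin_cases j <;> simp [RXg, Xg]
  rw [hR]
  generalize Real.cos (α / 2) = c
  generalize Real.sin (α / 2) = s
  have hI := Complex.I_sq
  ext i j
  fin_cases i <;> fin_cases j <;>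
    simp [rho0, Matrix.mul_apply, Fin.sum_univ_two] <;> grind

theorem RZg_eq (β : ℝ) : ∃ u v : ℂ, u * v = 1 ∧ RZg β = !![u, 0; 0, v] ∧
    (RZg β)ᴴ = !![v, 0; 0, u] := by
  refine ⟨_, _, ?_, rfl, ?_⟩
  · rw [← Complex.exp_add]
    ring_nf
    exact Complex.exp_zero
  · ext i j
    fin_cases i <;> fin_cases j <;> simp [RZg, ← Complex.exp_conj, map_ofNat]

/-- The noise damps the `X` signal by `(1 - 2γ₁)(1 - 2γ₂)` and the `Z` signal by `1 - 2γ₁`. -/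
theorem trace_noisyOut (γ₁ γ₂ α β : ℝ) :
    ((Xg + Zg) * noisyOut γ₁ γ₂ α β).trace =
      (1 - 2 * γ₁) * (1 - 2 * γ₂) * (Xg * noiselessOut α β).trace +
        (1 - 2 * γ₁) * (Zg * noiselessOut α β).trace := by
  obtain ⟨u, v, huv, hR, hR'⟩ := RZg_eq β
  rw [noisyOut, noiselessOut, RXg_state, hR', hR]
  simp [EXc, EZc, Xg, Zg, Matrix.trace_fin_two]
  grind

/-- The Pauli insertions keep the sign of the damped `X` signal and flip that of the `Z` signal. -/
theorem trace_noisyOutP (γ₁ γ₂ α β : ℝ) :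
    ((Xg + Zg) * noisyOutP γ₁ γ₂ α β).trace =
      (1 - 2 * γ₁) * (1 - 2 * γ₂) * (Xg * noiselessOut α β).trace -
        (1 - 2 * γ₁) * (Zg * noiselessOut α β).trace := by
  obtain ⟨u, v, huv, hR, hR'⟩ := RZg_eq β
  rw [noisyOutP, noiselessOut, RXg_state, hR', hR]
  simp [EXc, EZc, Xg, Zg, Matrix.trace_fin_two]
  grind

theorem one_sub_two_mul_ofReal_ne_zero {γ : ℝ} (h : γ ≠ 1 / 2) : (1 - 2 * γ : ℂ) ≠ 0 := by
  intro h0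
  apply h
  have : (1 - 2 * γ : ℝ) = 0 := by exact_mod_cast h0
  linarith

/-- Observation 3 (restored transferability): coefficients fitting both the
noisy relation and the Pauli-inserted noisy relation also satisfy the
noiseless relation. -/
theorem pauli_insertions_restore_transferability
    (θ φ γ₁ γ₂ : ℝ) (h1 : γ₁ ≠ 1 / 2) (h2 : γ₂ ≠ 1 / 2)
    (a : Fin 4 → Fin 4 → ℝ)
    (hnoisy : ((Xg + Zg) * noisyOut γ₁ γ₂ θ φ).trace =
      ∑ k : Fin 4, ∑ l : Fin 4, (a k l : ℂ) *
        ((Xg + Zg) *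
          noisyOut γ₁ γ₂ ((k : ℕ) * Real.pi / 2) ((l : ℕ) * Real.pi / 2)).trace)
    (hnoisyP : ((Xg + Zg) * noisyOutP γ₁ γ₂ θ φ).trace =
      ∑ k : Fin 4, ∑ l : Fin 4, (a k l : ℂ) *
        ((Xg + Zg) *
          noisyOutP γ₁ γ₂ ((k : ℕ) * Real.pi / 2) ((l : ℕ) * Real.pi / 2)).trace) :
    ((Xg + Zg) * noiselessOut θ φ).trace =
      ∑ k : Fin 4, ∑ l : Fin 4, (a k l : ℂ) *
        ((Xg + Zg) *
          noiselessOut ((k : ℕ) * Real.pi / 2) ((l : ℕ) * Real.pi / 2)).trace := by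
  have hp := one_sub_two_mul_ofReal_ne_zero h1
  have hq := one_sub_two_mul_ofReal_ne_zero h2
  simp only [trace_noisyOut, mul_add, mul_left_comm (a _ _ : ℂ), Finset.sum_add_distrib,
    ← Finset.mul_sum] at hnoisy
  simp only [trace_noisyOutP, mul_sub, mul_left_comm (a _ _ : ℂ), Finset.sum_sub_distrib,
    ← Finset.mul_sum] at hnoisyP
  simp only [add_mul, Matrix.trace_add, mul_add, Finset.sum_add_distrib]
  congr 1
  · apply mul_left_cancel₀ (mul_ne_zero hp hq)
    linear_combination (hnoisy + hnoisyP) / 2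
  · apply mul_left_cancel₀ hp
    linear_combination (hnoisy - hnoisyP) / 2
end
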